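/- Let μ be a positive integer and let C^(2^μ) be the multiset obtained from C by applying the squaring operation C ↦ C² iteratively μ times. Let n1 be a positive integer with n1 ≤ |S|, let OPT be the maximum coverage number in C over all subsets of S of size n1, and let OPT_μ be the maximum coverage number in C^(2^μ) over all subsets of S of size n1. Let ζ ≥ 1 be a real number. If S' is a subset of S of size n1 whose coverage number in C^(2^μ) is at least OPT_μ / ζ, then the coverage number of S' in C is at least OPT / ζ^(1/2^μ). -/

import Mathlib

/-- The coverage number of `S'` in `C`: the number of members of `C`, counted with
multiplicity, fully covered by (i.e. contained in) `S'`. -/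
def coverNum {α : Type*} [DecidableEq α] (C : Multiset (Finset α)) (S' : Finset α) : ℕ :=
  (C.filter (fun A => A ⊆ S')).card

/-- The multiset `C²`: unions `A ∪ B` over all ordered pairs of members of `C`,
with all repetitions kept. -/
def msq {α : Type*} [DecidableEq α] (C : Multiset (Finset α)) : Multiset (Finset α) :=
  C.bind (fun A => C.map (fun B => A ∪ B))

lemma coverNum_bind {α : Type*} [DecidableEq α] (C D : Multiset (Finset α)) (T : Finset α) :
    coverNum (C.bind (fun A => D.map (fun B => A ∪ B))) T = coverNum C T * coverNum D T := by
  unfold coverNum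
  induction C using Multiset.induction_on with
  | empty => simp
  | cons A C ih =>
    rw [Multiset.cons_bind, Multiset.filter_add, Multiset.card_add, ih, Multiset.filter_map,
      Multiset.card_map]
    by_cases h : A ⊆ T
    · rw [Multiset.filter_cons_of_pos (p := fun A => A ⊆ T) _ h, Multiset.card_cons]
      have : Multiset.filter ((fun A => A ⊆ T) ∘ fun B => A ∪ B) D
          = Multiset.filter (fun A => A ⊆ T) D := by
        apply Multiset.filter_congr
        intro B _
        simp [Finset.union_subset_iff, h]
      rw [this]
      ring
    · rw [Multiset.filter_cons_of_neg (p := fun A => A ⊆ T) _ h]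
      have : Multiset.filter ((fun A => A ⊆ T) ∘ fun B => A ∪ B) D = 0 := by
        rw [Multiset.filter_eq_nil]
        intro B _
        simp [Finset.union_subset_iff, h]
      rw [this]
      simp

lemma coverNum_iter {α : Type*} [DecidableEq α] (C : Multiset (Finset α)) (T : Finset α) (m : ℕ) :
    coverNum (msq^[m] C) T = coverNum C T ^ (2 ^ m) := by
  induction m with
  | zero => simp
  | succ m ih =>
    rw [Function.iterate_succ_apply', msq, coverNum_bind, ih, pow_succ 2 m, pow_mul, sq]

/-- If `S'` of size `n1` has coverage number in `C^(2^μ)` at least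
`OPT_μ / ζ`, then its coverage number in `C` is at least `OPT / ζ^(1/2^μ)`. -/
theorem stmt_8 {α : Type*} [DecidableEq α] (S : Finset α)
    (C : Multiset (Finset α)) (hC : ∀ A ∈ C, A ⊆ S)
    (μ : ℕ) (hμ : 1 ≤ μ)
    (n1 : ℕ) (hn1 : 1 ≤ n1) (hn1S : n1 ≤ S.card)
    (OPT OPTμ : ℕ)
    (hOPT : OPT = (S.powersetCard n1).sup (fun S' => coverNum C S'))
    (hOPTμ : OPTμ = (S.powersetCard n1).sup (fun S' => coverNum (msq^[μ] C) S'))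
    (ζ : ℝ) (hζ : 1 ≤ ζ)
    (S' : Finset α) (hS' : S' ⊆ S) (hS'card : S'.card = n1)
    (hcov : (OPTμ : ℝ) / ζ ≤ (coverNum (msq^[μ] C) S' : ℝ)) :
    (OPT : ℝ) / ζ ^ ((1 : ℝ) / 2 ^ μ) ≤ (coverNum C S' : ℝ) := by
  have hmem : S' ∈ S.powersetCard n1 := Finset.mem_powersetCard.2 ⟨hS', hS'card⟩
  obtain ⟨T, hT, hTe⟩ := Finset.exists_mem_eq_sup (S.powersetCard n1) ⟨S', hmem⟩
    (fun S' => coverNum C S')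
  have h1 : OPT ^ (2 ^ μ) ≤ OPTμ := by
    rw [hOPT, hTe, hOPTμ, ← coverNum_iter]
    exact Finset.le_sup (f := fun S' => coverNum (msq^[μ] C) S') hT
  have h1' : (OPT : ℝ) ^ (2 ^ μ) ≤ OPTμ := by exact_mod_cast h1
  have hz : 0 < ζ := by linarith
  rw [coverNum_iter, div_le_iff₀ hz] at hcov
  push_cast at hcov
  rw [div_le_iff₀ (Real.rpow_pos_of_pos hz _)]
  have hpow : (ζ ^ ((1 : ℝ) / 2 ^ μ)) ^ (2 ^ μ) = ζ := by
    have := Real.rpow_inv_natCast_pow hz.le (n := 2 ^ μ) (by positivity)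
    push_cast at this
    rw [one_div]
    exact this
  apply le_of_pow_le_pow_left₀ (n := 2 ^ μ) (by positivity) (by positivity)
  rw [mul_pow, hpow]
  exact h1'.trans hcov
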